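/- For every integer n ≥ 1, the Bell number B_n (the number of partitions of an n-element set into nonempty disjoint blocks) satisfies B_n < (0.792·n / log(n+1))^n, and consequently B_n ≤ 2^{n·log₂ n} = n^n. -/

import Mathlib

/-- The Bell number `B n`: the number of partitions of an `n`-element set into nonempty
pairwise disjoint blocks, formalized as the number of `Finpartition`s of `univ : Finset (Fin n)`. -/
noncomputable def bellNumber (n : ℕ) : ℕ :=
  Nat.card (Finpartition (Finset.univ : Finset (Fin n)))


lemma bell_succ_range (n : ℕ) :
    (n + 1).bell = ∑ i ∈ Finset.range (n + 1), n.choose i * i.bell := by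
  rw [Nat.bell_succ, ← Nat.range_succ_eq_Iic, ← Finset.sum_range_reflect]
  refine Finset.sum_congr rfl fun i hi => ?_
  have hi' : i ≤ n := by simpa [Nat.lt_succ_iff] using hi
  have h1 : n.succ - 1 - i = n - i := by omega
  rw [h1, Nat.choose_symm hi']
  congr 2
  omega

/-- Restricting to the complement of the block of `a`. -/
noncomputable def removeBlock {α : Type*} [DecidableEq α] (a : α) (s : Finset α)
    (P : Finpartition (insert a s)) : (Σ u : s.powerset, Finpartition u.1) :=
  ⟨⟨insert a s \ P.part a, by
    rw [Finset.mem_powerset]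
    intro x hx
    rw [Finset.mem_sdiff, Finset.mem_insert] at hx
    rcases hx with ⟨rfl | h, h2⟩
    · exact absurd (P.mem_part (Finset.mem_insert_self _ _)) h2
    · exact h⟩, P.avoid (P.part a)⟩

lemma removeBlock_parts {α : Type*} [DecidableEq α] (a : α) (s : Finset α)
    (P : Finpartition (insert a s)) :
    P.parts = insert (insert a s \ (removeBlock a s P).1.1) (removeBlock a s P).2.parts := by
  have hm : P.part a ∈ P.parts := P.part_mem.2 (Finset.mem_insert_self _ _)
  ext c
  simp only [removeBlock, Finset.mem_insert, Finpartition.mem_avoid,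
    Finset.sdiff_sdiff_eq_self (P.part_subset a)]
  constructor
  · intro hc
    by_cases h : c = P.part a
    · exact Or.inl h
    · right
      have hd : Disjoint c (P.part a) := P.disjoint hc hm h
      refine ⟨c, hc, fun hle => ?_, Finset.sdiff_eq_self_of_disjoint hd⟩
      exact P.ne_bot hc (disjoint_self.1 (hd.mono_right hle))
  · rintro (h | ⟨d, hd, hle, rfl⟩)
    · exact h ▸ hm
    · have hne : d ≠ P.part a := fun h => hle h.le
      have hdis : Disjoint d (P.part a) := P.disjoint hd hm hne
      rwa [Finset.sdiff_eq_self_of_disjoint hdis]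

lemma removeBlock_injective {α : Type*} [DecidableEq α] (a : α) (s : Finset α) :
    Function.Injective (removeBlock a s) := by
  intro P Q h
  apply Finpartition.ext
  rw [removeBlock_parts a s P, removeBlock_parts a s Q, h]

lemma card_finpartition_le {α : Type*} [DecidableEq α] (s : Finset α) :
    Nat.card (Finpartition s) ≤ (s.card).bell := by
  induction s using Finset.strongInduction with
  | H s ih =>
    rcases s.eq_empty_or_nonempty with rfl | ⟨a, ha⟩
    · have : Subsingleton (Finpartition (∅ : Finset α)) :=
        inferInstanceAs (Subsingleton (Finpartition (⊥ : Finset α)))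
      simpa using Finite.card_le_one_iff_subsingleton.2 this
    · obtain ⟨t, hat, rfl⟩ : ∃ t, a ∉ t ∧ insert a t = s :=
        ⟨s.erase a, Finset.notMem_erase _ _, Finset.insert_erase ha⟩
      have h1 := Nat.card_le_card_of_injective _ (removeBlock_injective a t)
      rw [Nat.card_sigma] at h1
      rw [Finset.card_insert_of_notMem hat, bell_succ_range]
      refine h1.trans ?_
      calc ∑ u : t.powerset, Nat.card (Finpartition u.1)
          ≤ ∑ u : t.powerset, (u.1.card).bell := by
            refine Finset.sum_le_sum fun u _ => ih _ ?_
            exact (Finset.mem_powerset.1 u.2).trans_ssubset (Finset.ssubset_insert hat)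
        _ = ∑ u ∈ t.powerset, (u.card).bell :=
            Finset.sum_coe_sort t.powerset (fun u => (u.card).bell)
        _ = _ := by
            rw [Finset.sum_powerset_apply_card]
            simp

lemma bellNumber_le_bell (n : ℕ) : bellNumber n ≤ n.bell := by
  have h := card_finpartition_le (Finset.univ : Finset (Fin n))
  rwa [Finset.card_univ, Fintype.card_fin] at h

/-- Dobinski's formula. -/
lemma dobinski (n : ℕ) :
    HasSum (fun k : ℕ => (k : ℝ) ^ n / (k.factorial : ℝ)) (n.bell * Real.exp 1) := by
  induction n using Nat.strong_induction_on with
  | _ n ih =>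
    rcases n with _ | n
    · have := NormedSpace.expSeries_div_hasSum_exp (1 : ℝ)
      rw [← Real.exp_eq_exp_ℝ] at this
      simpa using this
    · have h : HasSum (fun k : ℕ => ∑ i ∈ Finset.range (n + 1),
          (n.choose i : ℝ) * ((k : ℝ) ^ i / (k.factorial : ℝ)))
          (∑ i ∈ Finset.range (n + 1), (n.choose i : ℝ) * (i.bell * Real.exp 1)) :=
        hasSum_sum fun i hi => (ih i (Finset.mem_range.1 hi)).mul_left _
      rw [← hasSum_nat_add_iff' 1]
      convert h using 1
      · rfl
      · funext k
        have : ((k + 1 : ℕ) : ℝ) ^ (n + 1) / ((k + 1).factorial : ℝ)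
            = ((k : ℝ) + 1) ^ n / k.factorial := by
          rw [Nat.factorial_succ]
          push_cast
          have : (k.factorial : ℝ) ≠ 0 := by positivity
          field_simp
          ring
        rw [this, add_pow, Finset.sum_div]
        refine Finset.sum_congr rfl fun i _ => ?_
        simp
        ring
      · rw [bell_succ_range]
        push_cast
        simp [Finset.sum_mul, mul_assoc]

lemma bell_le_exp (n : ℕ) (hn : 1 ≤ n) (x : ℝ) (hx : 0 < x) :
    (n.bell : ℝ) ≤ (n / (Real.exp 1 * x)) ^ n * Real.exp (Real.exp x - 1) := by
  have hn0 : (0 : ℝ) < n := by exact_mod_cast hn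
  have h2 : HasSum (fun k : ℕ => (n / (Real.exp 1 * x)) ^ n *
      ((Real.exp x) ^ k / (k.factorial : ℝ)))
      ((n / (Real.exp 1 * x)) ^ n * Real.exp (Real.exp x)) := by
    have := NormedSpace.expSeries_div_hasSum_exp (Real.exp x)
    rw [← Real.exp_eq_exp_ℝ] at this
    exact this.mul_left _
  have h3 := hasSum_le (fun k : ℕ => ?_) (dobinski n) h2
  · rw [Real.exp_sub, ← mul_div_assoc, le_div_iff₀ (Real.exp_pos 1)]
    exact h3
  · rw [← mul_div_assoc]
    apply div_le_div_of_nonneg_right _ (by positivity)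
    have key : (k : ℝ) ≤ n / (Real.exp 1 * x) * Real.exp (k * x / n) := by
      have h := Real.add_one_le_exp (k * x / n - 1)
      rw [Real.exp_sub] at h
      have h' : (k : ℝ) * x / n ≤ Real.exp (k * x / n) / Real.exp 1 := by linarith
      have e : (k : ℝ) = (n / x) * (k * x / n) := by field_simp
      calc (k : ℝ) = (n / x) * (k * x / n) := e
        _ ≤ (n / x) * (Real.exp (k * x / n) / Real.exp 1) := by gcongr
        _ = _ := by field_simp
    calc (k : ℝ) ^ n ≤ (n / (Real.exp 1 * x) * Real.exp (k * x / n)) ^ n := by gcongr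
      _ = _ := by
        rw [mul_pow, ← Real.exp_nat_mul, ← Real.exp_nat_mul]
        congr 2
        field_simp

lemma bell_lt_large (n : ℕ) (hn : 15 ≤ n) :
    (n.bell : ℝ) < (0.792 * n / Real.log (n + 1)) ^ n := by
  have hn0 : (15 : ℝ) ≤ n := by exact_mod_cast hn
  have hL : 0 < Real.log (n + 1) := Real.log_pos (by linarith)
  set L := Real.log (n + 1) with hLdef
  have hb := bell_le_exp n (by omega) (2 / 3 * L) (by positivity)
  set t := Real.exp (L / 3) with ht
  have ht0 : 0 < t := Real.exp_pos _
  have ht3 : t ^ 3 = n + 1 := by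
    rw [ht, ← Real.exp_nat_mul]
    have : ((3 : ℕ) : ℝ) * (L / 3) = L := by push_cast; ring
    rw [this, hLdef, Real.exp_log (by linarith)]
  have ht2 : Real.exp (2 / 3 * L) = t ^ 2 := by
    rw [ht, ← Real.exp_nat_mul]
    congr 1
    push_cast
    ring
  have htge : (5 / 2 : ℝ) ≤ t := by
    by_contra h
    push Not at h
    have : t ^ 3 < (5 / 2 : ℝ) ^ 3 := by gcongr
    norm_num at this
    linarith
  have hr : t ^ 2 - 1 ≤ n * 0.36 := by
    have : (n : ℝ) = t ^ 3 - 1 := by linarith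
    rw [this]
    nlinarith [mul_nonneg (by linarith : (0 : ℝ) ≤ t - 1)
      (mul_nonneg (by linarith : (0 : ℝ) ≤ t - 5 / 2) (by linarith : (0 : ℝ) ≤ t)),
      mul_nonneg (by linarith : (0 : ℝ) ≤ t - 1) (by linarith : (0 : ℝ) ≤ t - 5 / 2)]
  have he : Real.exp 0.36 * 1.5 < 0.792 * Real.exp 1 := by
    have h1 : Real.exp 1 = Real.exp 0.36 * Real.exp 0.64 := by
      rw [← Real.exp_add]; norm_num
    have h2 : (1.896 : ℝ) < Real.exp 0.64 := by
      refine lt_of_lt_of_le ?_ (Real.sum_le_exp_of_nonneg (by norm_num) 10)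
      norm_num [Finset.sum_range_succ, Nat.factorial]
    rw [h1]
    nlinarith [Real.exp_pos 0.36]
  calc (n.bell : ℝ) ≤ (n / (Real.exp 1 * (2 / 3 * L))) ^ n * Real.exp (t ^ 2 - 1) := by
        rw [← ht2]; exact hb
    _ ≤ (n / (Real.exp 1 * (2 / 3 * L))) ^ n * Real.exp (n * 0.36) := by gcongr
    _ = (n / (Real.exp 1 * (2 / 3 * L)) * Real.exp 0.36) ^ n := by
        rw [mul_pow, ← Real.exp_nat_mul]
    _ < (0.792 * n / L) ^ n := by
        have hpos := Real.exp_pos 1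
        refine pow_lt_pow_left₀ ?_ (by positivity) (by omega)
        have e1 : n / (Real.exp 1 * (2 / 3 * L)) * Real.exp 0.36
            = (n / L) * ((Real.exp 0.36 * 1.5) / Real.exp 1) := by
          field_simp
          norm_num
        have e2 : 0.792 * n / L = (n / L) * 0.792 := by ring
        rw [e1, e2]
        have : 0 < (n : ℝ) / L := by positivity
        apply mul_lt_mul_of_pos_left _ this
        rw [div_lt_iff₀ hpos]
        exact he

lemma small_case (n b : ℕ) (q : ℝ) (hn : 1 ≤ n) (hb : n.bell = b) (hq0 : 0 < q)
    (hq : (n : ℝ) + 1 ≤ ∑ i ∈ Finset.range 18, q ^ i / (i.factorial : ℝ))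
    (h : (b : ℝ) < (0.792 * n / q) ^ n) :
    (n.bell : ℝ) < (0.792 * n / Real.log (n + 1)) ^ n := by
  have hn0 : (1 : ℝ) ≤ n := by exact_mod_cast hn
  have hL : 0 < Real.log (n + 1) := Real.log_pos (by linarith)
  have hLq : Real.log (n + 1) ≤ q := by
    rw [Real.log_le_iff_le_exp (by linarith)]
    exact hq.trans (Real.sum_le_exp_of_nonneg hq0.le 18)
  rw [hb]
  refine h.trans_le ?_
  gcongr

lemma bell_val_3 : Nat.bell 3 = 5 := by
  rw [bell_succ_range]
  simp [Finset.sum_range_succ, Nat.choose]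

lemma bell_val_4 : Nat.bell 4 = 15 := by
  rw [bell_succ_range]
  simp [Finset.sum_range_succ, Nat.choose, bell_val_3]

lemma bell_val_5 : Nat.bell 5 = 52 := by
  rw [bell_succ_range]
  simp [Finset.sum_range_succ, Nat.choose, bell_val_3, bell_val_4]

lemma bell_val_6 : Nat.bell 6 = 203 := by
  rw [bell_succ_range]
  simp [Finset.sum_range_succ, Nat.choose, bell_val_3, bell_val_4, bell_val_5]

lemma bell_val_7 : Nat.bell 7 = 877 := by
  rw [bell_succ_range]
  simp [Finset.sum_range_succ, Nat.choose, bell_val_3, bell_val_4, bell_val_5, bell_val_6]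

lemma bell_val_8 : Nat.bell 8 = 4140 := by
  rw [bell_succ_range]
  simp [Finset.sum_range_succ, Nat.choose, bell_val_3, bell_val_4, bell_val_5, bell_val_6, bell_val_7]

lemma bell_val_9 : Nat.bell 9 = 21147 := by
  rw [bell_succ_range]
  simp [Finset.sum_range_succ, Nat.choose, bell_val_3, bell_val_4, bell_val_5, bell_val_6, bell_val_7, bell_val_8]

lemma bell_val_10 : Nat.bell 10 = 115975 := by
  rw [bell_succ_range]
  simp [Finset.sum_range_succ, Nat.choose, bell_val_3, bell_val_4, bell_val_5, bell_val_6, bell_val_7, bell_val_8, bell_val_9]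

lemma bell_val_11 : Nat.bell 11 = 678570 := by
  rw [bell_succ_range]
  simp [Finset.sum_range_succ, Nat.choose, bell_val_3, bell_val_4, bell_val_5, bell_val_6, bell_val_7, bell_val_8, bell_val_9, bell_val_10]

lemma bell_val_12 : Nat.bell 12 = 4213597 := by
  rw [bell_succ_range]
  simp [Finset.sum_range_succ, Nat.choose, bell_val_3, bell_val_4, bell_val_5, bell_val_6, bell_val_7, bell_val_8, bell_val_9, bell_val_10, bell_val_11]

lemma bell_val_13 : Nat.bell 13 = 27644437 := by
  rw [bell_succ_range]
  simp [Finset.sum_range_succ, Nat.choose, bell_val_3, bell_val_4, bell_val_5, bell_val_6, bell_val_7, bell_val_8, bell_val_9, bell_val_10, bell_val_11, bell_val_12]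

lemma bell_val_14 : Nat.bell 14 = 190899322 := by
  rw [bell_succ_range]
  simp [Finset.sum_range_succ, Nat.choose, bell_val_3, bell_val_4, bell_val_5, bell_val_6, bell_val_7, bell_val_8, bell_val_9, bell_val_10, bell_val_11, bell_val_12, bell_val_13]

lemma bell_lt (n : ℕ) (hn : 1 ≤ n) :
    (n.bell : ℝ) < (0.792 * n / Real.log (n + 1)) ^ n := by
  rcases le_or_gt 15 n with h | h
  · exact bell_lt_large n h
  interval_cases n
  · exact small_case 1 _ 0.7 (by norm_num) Nat.bell_one (by norm_num)
      (by norm_num [Finset.sum_range_succ, Nat.factorial]) (by norm_num)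
  · exact small_case 2 _ 1.1 (by norm_num) Nat.bell_two (by norm_num)
      (by norm_num [Finset.sum_range_succ, Nat.factorial]) (by norm_num)
  · exact small_case 3 _ 1.388 (by norm_num) bell_val_3 (by norm_num)
      (by norm_num [Finset.sum_range_succ, Nat.factorial]) (by norm_num)
  · exact small_case 4 _ 1.6096 (by norm_num) bell_val_4 (by norm_num)
      (by norm_num [Finset.sum_range_succ, Nat.factorial]) (by norm_num)
  · exact small_case 5 _ 1.795 (by norm_num) bell_val_5 (by norm_num)
      (by norm_num [Finset.sum_range_succ, Nat.factorial]) (by norm_num)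
  · exact small_case 6 _ 1.955 (by norm_num) bell_val_6 (by norm_num)
      (by norm_num [Finset.sum_range_succ, Nat.factorial]) (by norm_num)
  · exact small_case 7 _ 2.1 (by norm_num) bell_val_7 (by norm_num)
      (by norm_num [Finset.sum_range_succ, Nat.factorial]) (by norm_num)
  · exact small_case 8 _ 2.23 (by norm_num) bell_val_8 (by norm_num)
      (by norm_num [Finset.sum_range_succ, Nat.factorial]) (by norm_num)
  · exact small_case 9 _ 2.35 (by norm_num) bell_val_9 (by norm_num)
      (by norm_num [Finset.sum_range_succ, Nat.factorial]) (by norm_num)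
  · exact small_case 10 _ 2.46 (by norm_num) bell_val_10 (by norm_num)
      (by norm_num [Finset.sum_range_succ, Nat.factorial]) (by norm_num)
  · exact small_case 11 _ 2.56 (by norm_num) bell_val_11 (by norm_num)
      (by norm_num [Finset.sum_range_succ, Nat.factorial]) (by norm_num)
  · exact small_case 12 _ 2.66 (by norm_num) bell_val_12 (by norm_num)
      (by norm_num [Finset.sum_range_succ, Nat.factorial]) (by norm_num)
  · exact small_case 13 _ 2.75 (by norm_num) bell_val_13 (by norm_num)
      (by norm_num [Finset.sum_range_succ, Nat.factorial]) (by norm_num)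
  · exact small_case 14 _ 2.84 (by norm_num) bell_val_14 (by norm_num)
      (by norm_num [Finset.sum_range_succ, Nat.factorial]) (by norm_num)

/-- For every `n ≥ 1`, the Bell number satisfies `B n < (0.792·n / log (n+1))^n`, and
consequently `B n ≤ 2^(n·log₂ n) = n^n`. -/
theorem bellNumber_lt (n : ℕ) (hn : 1 ≤ n) :
    (bellNumber n : ℝ) < (0.792 * n / Real.log (n + 1)) ^ n ∧
    (bellNumber n : ℝ) ≤ (2 : ℝ) ^ ((n : ℝ) * Real.logb 2 n) ∧
    (2 : ℝ) ^ ((n : ℝ) * Real.logb 2 n) = (n : ℝ) ^ n := by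
  have hn0 : (0 : ℝ) < n := by exact_mod_cast hn
  have hB : (bellNumber n : ℝ) ≤ n.bell := by exact_mod_cast bellNumber_le_bell n
  have h1 : (bellNumber n : ℝ) < (0.792 * n / Real.log (n + 1)) ^ n :=
    hB.trans_lt (bell_lt n hn)
  have h3 : (2 : ℝ) ^ ((n : ℝ) * Real.logb 2 n) = (n : ℝ) ^ n := by
    rw [mul_comm, Real.rpow_mul (by norm_num), Real.rpow_logb (by norm_num) (by norm_num) hn0,
      Real.rpow_natCast]
  refine ⟨h1, ?_, h3⟩
  rw [h3]
  rcases hn.eq_or_lt with rfl | h2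
  · simpa using hB
  · have h2' : (2 : ℝ) ≤ n := by exact_mod_cast h2
    have hL : 0.792 ≤ Real.log (n + 1) := by
      rw [Real.le_log_iff_exp_le (by linarith)]
      have : Real.exp 0.792 ≤ Real.exp 1 := Real.exp_le_exp.2 (by norm_num)
      linarith [Real.exp_one_lt_d9]
    have hL0 : 0 < Real.log (n + 1) := by linarith
    refine h1.le.trans ?_
    gcongr
    rw [div_le_iff₀ hL0]
    nlinarith
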